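/- Let Γ be a countable set, and for each k ∈ Γ let p_k and q_k be probability measures on a measurable space M_k. Let μ := ⊗_{k∈Γ} p_k and ν := ⊗_{k∈Γ} q_k be the corresponding product probability measures on the product space ∏_{k∈Γ} M_k. Then ‖μ − ν‖_TV ≤ ∑_{k∈Γ} ‖q_k − p_k‖_TV. -/

import Mathlib

open MeasureTheory ProbabilityTheory

/-- The total variation distance `sup_A |μ(A) - ν(A)|` between two measures,
the supremum ranging over measurable sets. -/
noncomputable def tvDist {X : Type*} [MeasurableSpace X] (μ ν : Measure X) : ℝ :=
  ⨆ A : {A : Set X // MeasurableSet A}, |(μ A).toReal - (ν A).toReal|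

open Set in
/-- Resampling one coordinate of a product measure. -/
theorem infinitePi_resample {Γ : Type*} {M : Γ → Type*} [∀ k, MeasurableSpace (M k)]
    [DecidableEq Γ] (r : ∀ k, Measure (M k)) [∀ k, IsProbabilityMeasure (r k)]
    (s : ∀ k, Measure (M k)) [∀ k, IsProbabilityMeasure (s k)] (k : Γ)
    (h : ∀ j, j ≠ k → s j = r j) :
    ((Measure.infinitePi r).prod (s k)).map
      (fun z : (∀ i, M i) × M k => Function.update z.1 k z.2) = Measure.infinitePi s := by
  apply Measure.eq_infinitePi
  intro J t ht
  have hJ : MeasurableSet (Set.pi (J : Set Γ) t) :=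
    MeasurableSet.pi J.countable_toSet (fun i _ => ht i)
  rw [Measure.map_apply measurable_update' hJ]
  by_cases hk : k ∈ J
  · have : (fun z : (∀ i, M i) × M k => Function.update z.1 k z.2) ⁻¹' (Set.pi (J : Set Γ) t)
        = (Set.pi ((J.erase k : Finset Γ) : Set Γ) t) ×ˢ (t k) := by
      ext ⟨x, y⟩
      simp only [mem_preimage, mem_prod, Set.mem_pi, Finset.mem_coe, Finset.mem_erase]
      constructor
      · intro H
        refine ⟨fun i hi => ?_, ?_⟩
        · have := H i hi.2
          rwa [Function.update_of_ne hi.1] at this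
        · have := H k hk
          rwa [Function.update_self] at this
      · rintro ⟨H1, H2⟩ i hi
        by_cases hik : i = k
        · subst hik
          rwa [Function.update_self]
        · rw [Function.update_of_ne hik]
          exact H1 i ⟨hik, hi⟩
    rw [this, Measure.prod_prod, Measure.infinitePi_pi _ (fun i _ => ht i),
      ← Finset.prod_erase_mul J _ hk]
    congr 1
    refine Finset.prod_congr rfl fun i hi => ?_
    rw [h i (Finset.ne_of_mem_erase hi)]
  · have : (fun z : (∀ i, M i) × M k => Function.update z.1 k z.2) ⁻¹' (Set.pi (J : Set Γ) t)
        = (Set.pi (J : Set Γ) t) ×ˢ univ := by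
      ext ⟨x, y⟩
      simp only [mem_preimage, mem_prod, Set.mem_pi, Finset.mem_coe, mem_univ, and_true]
      refine forall₂_congr fun i hi => ?_
      have hik : i ≠ k := fun e => hk (e ▸ hi)
      rw [Function.update_of_ne hik]
    rw [this, Measure.prod_prod, Measure.infinitePi_pi _ (fun i _ => ht i), measure_univ, mul_one]
    refine Finset.prod_congr rfl fun i hi => ?_
    rw [h i (fun e => hk (e ▸ hi))]

theorem infinitePi_step {Γ : Type*} {M : Γ → Type*} [∀ k, MeasurableSpace (M k)]
    (r : ∀ k, Measure (M k)) [∀ k, IsProbabilityMeasure (r k)]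
    (s : ∀ k, Measure (M k)) [∀ k, IsProbabilityMeasure (s k)] (k : Γ)
    (h : ∀ j, j ≠ k → s j = r j) (d : ENNReal)
    (hd : ∀ B, MeasurableSet B → r k B ≤ s k B + d)
    (A : Set (∀ k, M k)) (hA : MeasurableSet A) :
    Measure.infinitePi r A ≤ Measure.infinitePi s A + d := by
  classical
  have hA' := measurable_update' (a := k) (X := M) hA
  rw [← infinitePi_resample r s k h]
  conv_lhs => rw [← infinitePi_resample r r k (fun _ _ => rfl)]
  rw [Measure.map_apply measurable_update' hA, Measure.map_apply measurable_update' hA,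
    Measure.prod_apply hA', Measure.prod_apply hA']
  calc _ ≤ ∫⁻ x, (s k (Prod.mk x ⁻¹' ((fun z : (∀ i, M i) × M k =>
            Function.update z.1 k z.2) ⁻¹' A)) + d) ∂(Measure.infinitePi r) :=
        lintegral_mono fun x => hd _ (measurable_prodMk_left hA')
    _ = _ := by
        rw [lintegral_add_right _ measurable_const]
        simp

theorem infinitePi_hybrid {Γ : Type*} {M : Γ → Type*} [∀ k, MeasurableSpace (M k)]
    [DecidableEq Γ] (p : ∀ k, Measure (M k)) [∀ k, IsProbabilityMeasure (p k)]
    (q : ∀ k, Measure (M k)) [∀ k, IsProbabilityMeasure (q k)] (d : Γ → ENNReal)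
    (hd : ∀ k B, MeasurableSet B → p k B ≤ q k B + d k)
    (A : Set (∀ k, M k)) (hA : MeasurableSet A) (J : Finset Γ)
    [∀ J : Finset Γ, ∀ k, IsProbabilityMeasure (if k ∈ J then q k else p k)] :
    Measure.infinitePi p A ≤
      Measure.infinitePi (fun k => if k ∈ J then q k else p k) A + ∑ k ∈ J, d k := by
  induction J using Finset.induction_on with
  | empty => simp
  | insert a J ha ih =>
    refine ih.trans ?_
    rw [Finset.sum_insert ha, ← add_assoc]
    gcongr
    refine infinitePi_step _ _ a (fun j hj => ?_) _ (fun B hB => ?_) A hA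
    · simp [hj]
    · simpa [ha] using hd a B hB

theorem infinitePi_le_tsum {Γ : Type*} {M : Γ → Type*} [∀ k, MeasurableSpace (M k)]
    (p : ∀ k, Measure (M k)) [∀ k, IsProbabilityMeasure (p k)]
    (q : ∀ k, Measure (M k)) [∀ k, IsProbabilityMeasure (q k)] (d : Γ → ENNReal)
    (hd : ∀ k B, MeasurableSet B → p k B ≤ q k B + d k)
    (A : Set (∀ k, M k)) (hA : MeasurableSet A) :
    Measure.infinitePi p A ≤ Measure.infinitePi q A + ∑' k, d k := by
  classical
  have hinst : ∀ J : Finset Γ, ∀ k, IsProbabilityMeasure (if k ∈ J then q k else p k) := by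
    intro J k
    split_ifs <;> infer_instance
  refine ENNReal.le_of_forall_pos_le_add fun ε hε _ => ?_
  obtain ⟨C, hC, hCA⟩ := exists_measure_symmDiff_lt_of_generateFrom_isSetRing
    (μ := Measure.infinitePi p + Measure.infinitePi q) (C := measurableCylinders M)
    isSetRing_measurableCylinders
    ⟨{Set.univ}, Set.countable_singleton _, Set.singleton_subset_iff.2 (univ_mem_measurableCylinders M), by simp⟩
    generateFrom_measurableCylinders.symm hA (ε := (ε : ENNReal)) (by exact_mod_cast hε)
  have hCm := MeasurableSet.of_mem_measurableCylinders hC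
  obtain ⟨J, S, hS, rfl⟩ := (mem_measurableCylinders C).1 hC
  have h1 := infinitePi_hybrid p q d hd _ hCm J
  have h2 : Measure.infinitePi (fun k => if k ∈ J then q k else p k) (cylinder J S)
      = Measure.infinitePi q (cylinder J S) := by
    rw [Measure.infinitePi_cylinder _ hS, Measure.infinitePi_cylinder _ hS]
    congr 1
    congr 1
    funext i
    simp
  rw [h2] at h1
  set C := cylinder J S
  have e1 : Measure.infinitePi p A ≤ Measure.infinitePi p C
      + Measure.infinitePi p (symmDiff C A) := by
    refine (measure_mono ?_).trans (measure_union_le _ _)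
    intro x hx
    by_cases hxC : x ∈ C
    · exact Or.inl hxC
    · exact Or.inr (Or.inr ⟨hx, hxC⟩)
  have e2 : Measure.infinitePi q C ≤ Measure.infinitePi q A
      + Measure.infinitePi q (symmDiff C A) := by
    refine (measure_mono ?_).trans (measure_union_le _ _)
    intro x hx
    by_cases hxC : x ∈ A
    · exact Or.inl hxC
    · exact Or.inr (Or.inl ⟨hx, hxC⟩)
  rw [Measure.add_apply] at hCA
  calc _ ≤ Measure.infinitePi q A + Measure.infinitePi q (symmDiff C A) + ∑ k ∈ J, d k
        + Measure.infinitePi p (symmDiff C A) := e1.trans (by gcongr; exact h1.trans (by gcongr))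
    _ = Measure.infinitePi q A + ∑ k ∈ J, d k +
        (Measure.infinitePi p (symmDiff C A) + Measure.infinitePi q (symmDiff C A)) := by ring
    _ ≤ _ := by gcongr; exact ENNReal.sum_le_tsum J

theorem abs_le_tvDist {X : Type*} [MeasurableSpace X] (μ ν : Measure X)
    [IsProbabilityMeasure μ] [IsProbabilityMeasure ν] (A : Set X) (hA : MeasurableSet A) :
    |(μ A).toReal - (ν A).toReal| ≤ tvDist μ ν := by
  refine le_ciSup (f := fun A : {A : Set X // MeasurableSet A} =>
    |(μ A).toReal - (ν A).toReal|) ⟨1, ?_⟩ ⟨A, hA⟩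
  rintro _ ⟨B, rfl⟩
  have h1 : (μ B).toReal ≤ 1 := measureReal_le_one
  have h2 : (ν B).toReal ≤ 1 := measureReal_le_one
  have h3 : 0 ≤ (μ B).toReal := ENNReal.toReal_nonneg
  have h4 : 0 ≤ (ν B).toReal := ENNReal.toReal_nonneg
  exact abs_le.2 ⟨by linarith, by linarith⟩

theorem le_add_of_abs_le {a b : ENNReal} (ha : a ≠ ⊤) (hb : b ≠ ⊤) {d : ℝ}
    (h : a.toReal - b.toReal ≤ d) : a ≤ b + ENNReal.ofReal d := by
  rw [← ENNReal.ofReal_toReal ha, ← ENNReal.ofReal_toReal hb]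
  refine (ENNReal.ofReal_le_ofReal ?_).trans ENNReal.ofReal_add_le
  linarith

/-- If `μ = ⊗_k p_k` and `ν = ⊗_k q_k` are product probability measures on a countable
product space (characterized by their values on cylinder sets), then
`‖μ - ν‖_TV ≤ ∑_k ‖q_k - p_k‖_TV`. -/
theorem tvDist_product_le_tsum_tvDist
    {Γ : Type*} [Countable Γ] {M : Γ → Type*} [∀ k, MeasurableSpace (M k)]
    (p q : ∀ k, Measure (M k))
    [∀ k, IsProbabilityMeasure (p k)] [∀ k, IsProbabilityMeasure (q k)]
    (μ ν : Measure (∀ k, M k)) [IsProbabilityMeasure μ] [IsProbabilityMeasure ν]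
    (hμ : ∀ (J : Finset Γ) (B : ∀ k, Set (M k)), (∀ k, MeasurableSet (B k)) →
      μ {a | ∀ k ∈ J, a k ∈ B k} = ∏ k ∈ J, p k (B k))
    (hν : ∀ (J : Finset Γ) (B : ∀ k, Set (M k)), (∀ k, MeasurableSet (B k)) →
      ν {a | ∀ k ∈ J, a k ∈ B k} = ∏ k ∈ J, q k (B k)) :
    ENNReal.ofReal (tvDist μ ν) ≤ ∑' k : Γ, ENNReal.ofReal (tvDist (q k) (p k)) := by
  have hμ' : μ = Measure.infinitePi p := Measure.eq_infinitePi _ (fun J B hB => hμ J B hB)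
  have hν' : ν = Measure.infinitePi q := Measure.eq_infinitePi _ (fun J B hB => hν J B hB)
  by_cases htop : ∑' k : Γ, ENNReal.ofReal (tvDist (q k) (p k)) = ⊤
  · rw [htop]; exact le_top
  apply ENNReal.ofReal_le_of_le_toReal
  haveI : Nonempty {A : Set (∀ k, M k) // MeasurableSet A} := ⟨⟨∅, MeasurableSet.empty⟩⟩
  refine ciSup_le ?_
  rintro ⟨A, hA⟩
  have h1 : μ A ≤ ν A + ∑' k : Γ, ENNReal.ofReal (tvDist (q k) (p k)) := by
    rw [hμ', hν']
    refine infinitePi_le_tsum p q _ (fun k B hB => ?_) A hA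
    refine le_add_of_abs_le (measure_ne_top _ _) (measure_ne_top _ _) ?_
    have := (abs_le.1 (abs_le_tvDist (q k) (p k) B hB)).1
    linarith
  have h2 : ν A ≤ μ A + ∑' k : Γ, ENNReal.ofReal (tvDist (q k) (p k)) := by
    rw [hμ', hν']
    refine infinitePi_le_tsum q p _ (fun k B hB => ?_) A hA
    refine le_add_of_abs_le (measure_ne_top _ _) (measure_ne_top _ _) ?_
    exact (abs_le.1 (abs_le_tvDist (q k) (p k) B hB)).2
  have h1' := ENNReal.toReal_mono (ENNReal.add_ne_top.2 ⟨measure_ne_top _ _, htop⟩) h1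
  have h2' := ENNReal.toReal_mono (ENNReal.add_ne_top.2 ⟨measure_ne_top _ _, htop⟩) h2
  rw [ENNReal.toReal_add (measure_ne_top _ _) htop] at h1' h2'
  exact abs_le.2 ⟨by linarith, by linarith⟩
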